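/- The second-smallest eigenvalue function λ₂(k) of Δ(k) attains, at some k₀ ∈ (0, π), a value strictly larger than both λ₂(0) and λ₂(π); hence the maximum of λ₂ over [0,π] is not attained at k = 0 or k = π. -/

import Mathlib

open Complex

/-- The Floquet matrix Δ(k) of the discrete Laplace–Beltrami operator. -/
noncomputable def Delta (k : ℝ) : Matrix (Fin 5) (Fin 5) ℂ :=
  ((Real.sqrt 3 : ℂ))⁻¹ •
    !![0, ((Real.sqrt 3 : ℂ))⁻¹, exp (I * k) / 2, 0, ((Real.sqrt 3 : ℂ))⁻¹;
       ((Real.sqrt 3 : ℂ))⁻¹, 0, 1 / 2, exp (I * k) / (Real.sqrt 3 : ℂ), 0;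
       exp (-(I * k)) / 2, 1 / 2, 0, 1 / 2, 1 / 2;
       0, exp (-(I * k)) / (Real.sqrt 3 : ℂ), 1 / 2, 0, ((Real.sqrt 3 : ℂ))⁻¹;
       ((Real.sqrt 3 : ℂ))⁻¹, 0, 1 / 2, ((Real.sqrt 3 : ℂ))⁻¹, 0]

/-- The eigenvalues of a Hermitian matrix, sorted in nondecreasing order. -/
noncomputable def sortedEig {n : ℕ} {A : Matrix (Fin n) (Fin n) ℂ}
    (hA : A.IsHermitian) : Fin n → ℝ :=
  hA.eigenvalues ∘ Tuple.sort hA.eigenvalues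

/-- The characteristic polynomial of `3 • Δ(k)`, as a function of `C = cos k`. -/
noncomputable def floquetPoly (C y : ℝ) : ℝ :=
  y ^ 5 - 7 * y ^ 3 - (3 / 2 + 9 / 2 * C) * y ^ 2 + (5 - 5 * C) * y + 3 * C - 3 * C ^ 2

theorem det_floquet {R : Type*} [Field R] [CharZero R] (t z w x : R)
    (ht : t ^ 2 = 1 / 3) (hzw : z * w = 1) :
    (!![x, -(t * t), -(t * (z / 2)), 0, -(t * t);
        -(t * t), x, -(t * (1 / 2)), -(t * (z * t)), 0;
        -(t * (w / 2)), -(t * (1 / 2)), x, -(t * (1 / 2)), -(t * (1 / 2));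
        0, -(t * (w * t)), -(t * (1 / 2)), x, -(t * t);
        -(t * t), 0, -(t * (1 / 2)), -(t * t), x]).det * 243 =
      (3 * x) ^ 5 - 7 * (3 * x) ^ 3 - (3 / 2 + 9 / 2 * ((z + w) / 2)) * (3 * x) ^ 2
        + (5 - 5 * ((z + w) / 2)) * (3 * x) + 3 * ((z + w) / 2) - 3 * ((z + w) / 2) ^ 2 := by
  have ht4 : t ^ 4 = 1 / 9 := by linear_combination (t ^ 2 + 1 / 3) * ht
  simp [Matrix.det_succ_row_zero, Fin.sum_univ_succ, Fin.succAbove]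
  grind

theorem sortedEig_monotone {n : ℕ} {A : Matrix (Fin n) (Fin n) ℂ} (hA : A.IsHermitian) :
    Monotone (sortedEig hA) :=
  Tuple.monotone_sort _

theorem det_sub_eq_prod_sortedEig {n : ℕ} {A : Matrix (Fin n) (Fin n) ℂ} (hA : A.IsHermitian)
    (x : ℝ) : (Matrix.scalar (Fin n) (x : ℂ) - A).det = ((∏ i, (x - sortedEig hA i) : ℝ) : ℂ) := by
  rw [← Matrix.eval_charpoly, hA.charpoly_eq, Polynomial.eval_prod]
  have hsort : ∏ i, (x - sortedEig hA i) = ∏ i, (x - hA.eigenvalues i) :=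
    Equiv.prod_comp (Tuple.sort hA.eigenvalues) fun i => x - hA.eigenvalues i
  rw [hsort]
  simp

theorem prod_sub_sortedEig_Delta (k : ℝ) (hk : (Delta k).IsHermitian) (x : ℝ) :
    (∏ i, (x - sortedEig hk i)) * 243 = floquetPoly (Real.cos k) (3 * x) := by
  have ht : ((Real.sqrt 3 : ℂ)⁻¹) ^ 2 = 1 / 3 := by
    rw [inv_pow, ← ofReal_pow, Real.sq_sqrt (by norm_num)]
    norm_num
  have hzw : exp (I * k) * exp (-(I * k)) = 1 := by rw [← exp_add]; simp
  have hcos : ((Real.cos k : ℝ) : ℂ) = (exp (I * k) + exp (-(I * k))) / 2 := by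
    rw [ofReal_cos, Complex.cos]
    ring_nf
  have hdet := det_floquet _ _ _ (x : ℂ) ht hzw
  rw [← hcos] at hdet
  apply ofReal_injective
  rw [ofReal_mul, ← det_sub_eq_prod_sortedEig hk]
  simp only [floquetPoly]
  push_cast at hdet ⊢
  rw [← hdet]
  congr 2
  ext i j
  fin_cases i <;> fin_cases j <;> simp [Delta, div_eq_mul_inv]

/-- A monotone family has its second member below `b` if its root polynomial is positive at some
`a ≤ b` and negative at `b`. -/
theorem second_lt_of_prod_sub {f : Fin 5 → ℝ} (hf : Monotone f) {a b : ℝ} (hab : a ≤ b)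
    (ha : 0 < ∏ i, (a - f i)) (hb : ∏ i, (b - f i) < 0) : f 1 < b := by
  have h01 : f 0 ≤ f 1 := hf (by decide)
  have h12 : f 1 ≤ f 2 := hf (by decide)
  have h23 : f 2 ≤ f 3 := hf (by decide)
  have h34 : f 3 ≤ f 4 := hf (by decide)
  rw [Fin.prod_univ_five] at ha hb
  have h0 : f 0 < a := by
    by_contra! h
    refine ha.not_ge (mul_nonpos_of_nonneg_of_nonpos (mul_nonneg_of_nonpos_of_nonpos
      (mul_nonpos_of_nonneg_of_nonpos (mul_nonneg_of_nonpos_of_nonpos ?_ ?_) ?_) ?_) ?_) <;> linarith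
  by_contra! h
  refine hb.not_ge (mul_nonneg_of_nonpos_of_nonpos (mul_nonpos_of_nonneg_of_nonpos
    (mul_nonneg_of_nonpos_of_nonpos (mul_nonpos_of_nonneg_of_nonpos ?_ ?_) ?_) ?_) ?_) <;> linarith

/-- A monotone family has its second member above `a` if its root polynomial alternates in sign
along `a ≤ b ≤ c ≤ d`, starting with a positive value at `a`. -/
theorem lt_second_of_prod_sub {f : Fin 5 → ℝ} (hf : Monotone f) {a b c d : ℝ}
    (hab : a ≤ b) (hbc : b ≤ c) (hcd : c ≤ d)
    (ha : 0 < ∏ i, (a - f i)) (hb : ∏ i, (b - f i) < 0)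
    (hc : 0 < ∏ i, (c - f i)) (hd : ∏ i, (d - f i) < 0) : a < f 1 := by
  have h01 : f 0 ≤ f 1 := hf (by decide)
  have h12 : f 1 ≤ f 2 := hf (by decide)
  have h23 : f 2 ≤ f 3 := hf (by decide)
  have h34 : f 3 ≤ f 4 := hf (by decide)
  rw [Fin.prod_univ_five] at ha hb hc hd
  have h4 : d < f 4 := by
    by_contra! h
    refine hd.not_ge (mul_nonneg (mul_nonneg (mul_nonneg (mul_nonneg ?_ ?_) ?_) ?_) ?_) <;> linarith
  have h3 : c < f 3 := by
    by_contra! h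
    refine hc.not_ge (mul_nonpos_of_nonneg_of_nonpos
      (mul_nonneg (mul_nonneg (mul_nonneg ?_ ?_) ?_) ?_) ?_) <;> linarith
  have h2 : b < f 2 := by
    by_contra! h
    refine hb.not_ge (mul_nonneg_of_nonpos_of_nonpos (mul_nonpos_of_nonneg_of_nonpos
      (mul_nonneg (mul_nonneg ?_ ?_) ?_) ?_) ?_) <;> linarith
  by_contra! h
  refine ha.not_ge (mul_nonpos_of_nonneg_of_nonpos (mul_nonneg_of_nonpos_of_nonpos
    (mul_nonpos_of_nonneg_of_nonpos (mul_nonneg ?_ ?_) ?_) ?_) ?_) <;> linarith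

theorem prod_sub_sortedEig_Delta_pos_iff (k : ℝ) (hk : (Delta k).IsHermitian) (x : ℝ) :
    0 < ∏ i, (x - sortedEig hk i) ↔ 0 < floquetPoly (Real.cos k) (3 * x) := by
  rw [← prod_sub_sortedEig_Delta k hk, mul_pos_iff_of_pos_right (by norm_num)]

theorem prod_sub_sortedEig_Delta_neg_iff (k : ℝ) (hk : (Delta k).IsHermitian) (x : ℝ) :
    ∏ i, (x - sortedEig hk i) < 0 ↔ floquetPoly (Real.cos k) (3 * x) < 0 := by
  rw [← prod_sub_sortedEig_Delta k hk]
  constructor <;> intro h <;> linarith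

theorem sortedEig_Delta_zero_lt (hk : (Delta 0).IsHermitian) :
    sortedEig hk 1 < -19 / 60 := by
  refine second_lt_of_prod_sub (sortedEig_monotone hk) (a := -1 / 2) (by norm_num) ?_ ?_
  · rw [prod_sub_sortedEig_Delta_pos_iff, Real.cos_zero]
    norm_num [floquetPoly]
  · rw [prod_sub_sortedEig_Delta_neg_iff, Real.cos_zero]
    norm_num [floquetPoly]

theorem sortedEig_Delta_pi_lt (hk : (Delta Real.pi).IsHermitian) :
    sortedEig hk 1 < -19 / 60 := by
  refine second_lt_of_prod_sub (sortedEig_monotone hk) (a := -1 / 2) (by norm_num) ?_ ?_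
  · rw [prod_sub_sortedEig_Delta_pos_iff, Real.cos_pi]
    norm_num [floquetPoly]
  · rw [prod_sub_sortedEig_Delta_neg_iff, Real.cos_pi]
    norm_num [floquetPoly]

theorem lt_sortedEig_Delta_pi_div_three (hk : (Delta (Real.pi / 3)).IsHermitian) :
    -19 / 60 < sortedEig hk 1 := by
  refine lt_second_of_prod_sub (sortedEig_monotone hk) (b := -1 / 6) (c := 0) (d := 1 / 3)
    (by norm_num) (by norm_num) (by norm_num) ?_ ?_ ?_ ?_
  · rw [prod_sub_sortedEig_Delta_pos_iff, Real.cos_pi_div_three]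
    norm_num [floquetPoly]
  · rw [prod_sub_sortedEig_Delta_neg_iff, Real.cos_pi_div_three]
    norm_num [floquetPoly]
  · rw [prod_sub_sortedEig_Delta_pos_iff, Real.cos_pi_div_three]
    norm_num [floquetPoly]
  · rw [prod_sub_sortedEig_Delta_neg_iff, Real.cos_pi_div_three]
    norm_num [floquetPoly]

/-- the second-smallest eigenvalue function λ₂ attains at some k₀ ∈ (0,π)
a value strictly larger than both λ₂(0) and λ₂(π); hence its maximum over [0,π] is not
attained at k = 0 or k = π. -/
theorem Delta_lambda2_interior_max (h : ∀ k : ℝ, (Delta k).IsHermitian) :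
    (∃ k₀ ∈ Set.Ioo (0 : ℝ) Real.pi,
      sortedEig (h k₀) 1 > max (sortedEig (h 0) 1) (sortedEig (h Real.pi) 1)) ∧
    ¬ (∀ k ∈ Set.Icc (0 : ℝ) Real.pi, sortedEig (h k) 1 ≤ sortedEig (h 0) 1) ∧
    ¬ (∀ k ∈ Set.Icc (0 : ℝ) Real.pi, sortedEig (h k) 1 ≤ sortedEig (h Real.pi) 1) := by
  have h0 := sortedEig_Delta_zero_lt (h 0)
  have hpi := sortedEig_Delta_pi_lt (h Real.pi)
  have hmid := lt_sortedEig_Delta_pi_div_three (h (Real.pi / 3))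
  have hmem : Real.pi / 3 ∈ Set.Ioo (0 : ℝ) Real.pi := by
    constructor <;> linarith [Real.pi_pos]
  refine ⟨⟨Real.pi / 3, hmem, max_lt (h0.trans hmid) (hpi.trans hmid)⟩, fun hmax => ?_,
    fun hmax => ?_⟩
  · exact (hmax _ (Set.Ioo_subset_Icc_self hmem)).not_gt (h0.trans hmid)
  · exact (hmax _ (Set.Ioo_subset_Icc_self hmem)).not_gt (hpi.trans hmid)
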